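/- Let k : [0, ∞) → (0, ∞) be continuous with ∫₀^∞ ρ·k(ρ)² dρ < ∞, and let G : [0, ∞) → ℝ be twice continuously differentiable with G(0) = 0, G'(0) = 1, and G''(ρ) = k(ρ)²·G(ρ) for all ρ ≥ 0. Then ∫₁^∞ (G'(ρ)/G(ρ) − 1/ρ) dρ < ∞, i.e., the nonnegative function ρ ↦ G'(ρ)/G(ρ) − 1/ρ is integrable on [1, ∞). -/

import Mathlib

open MeasureTheory Set Filter Topology

/-- A function with nonnegative derivative on `[a, ∞)` is monotone there. -/
theorem monotoneOn_Ici_of_hasDerivWithinAt_nonneg {a : ℝ} {f f' : ℝ → ℝ}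
    (hf : ∀ x ∈ Ici a, HasDerivWithinAt f (f' x) (Ici a) x)
    (hf' : ∀ x ∈ Ici a, 0 ≤ f' x) : MonotoneOn f (Ici a) :=
  monotoneOn_of_hasDerivWithinAt_nonneg (convex_Ici a)
    (fun x hx => (hf x hx).continuousWithinAt)
    (fun x hx => (hf x (interior_subset hx)).mono interior_subset)
    (fun x hx => hf' x (interior_subset hx))

/-- A nonnegative derivative of a function bounded above on `[a, ∞)` is integrable. -/
theorem integrableOn_Ici_deriv_of_nonneg_of_le {a C : ℝ} {f f' : ℝ → ℝ}
    (hf : ∀ x ∈ Ici a, HasDerivAt f (f' x) x)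
    (hf' : ∀ x ∈ Ici a, 0 ≤ f' x) (hC : ∀ x ∈ Ici a, f x ≤ C) :
    IntegrableOn f' (Ici a) := by
  have hmono : MonotoneOn f (Ici a) :=
    monotoneOn_Ici_of_hasDerivWithinAt_nonneg (fun x hx => (hf x hx).hasDerivWithinAt) hf'
  have hmono' : Monotone fun x => f (max a x) := fun x y hxy =>
    hmono (mem_Ici.2 (le_max_left _ _)) (mem_Ici.2 (le_max_left _ _)) (max_le_max le_rfl hxy)
  have hlim := tendsto_atTop_ciSup hmono'
    ⟨C, by rintro _ ⟨x, rfl⟩; exact hC _ (mem_Ici.2 (le_max_left _ _))⟩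
  rw [integrableOn_Ici_iff_integrableOn_Ioi]
  refine integrableOn_Ioi_deriv_of_nonneg' hf (fun x hx => hf' x (Ioi_subset_Ici_self hx))
    (hlim.congr' ?_)
  filter_upwards [eventually_ge_atTop a] with x hx
  rw [max_eq_right hx]

/-- A linear Grönwall bound with an integrable coefficient. -/
theorem le_mul_exp_setIntegral_of_deriv_le_mul {a : ℝ} {q f f' : ℝ → ℝ}
    (hq : ContinuousOn q (Ici a)) (hq0 : ∀ x ∈ Ici a, 0 ≤ q x)
    (hqi : IntegrableOn q (Ici a)) (hf : ∀ x ∈ Ici a, HasDerivAt f (f' x) x)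
    (hle : ∀ x ∈ Ici a, f' x ≤ q x * f x) (hf0 : 0 ≤ f a) {x : ℝ} (hx : x ∈ Ici a) :
    f x ≤ f a * Real.exp (∫ t in Ici a, q t) := by
  have hΦ : ∀ y ∈ Ici a, HasDerivWithinAt (fun y => ∫ t in a..y, q t) (q y) (Ici a) y := by
    intro y hy
    have hay : IntervalIntegrable q volume a y :=
      (hq.mono Icc_subset_Ici_self).intervalIntegrable_of_Icc hy
    rcases eq_or_lt_of_le (mem_Ici.1 hy) with rfl | hlt
    · exact intervalIntegral.integral_hasDerivWithinAt_right hay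
        ((hq.stronglyMeasurableAtFilter_nhdsWithin measurableSet_Ici a).filter_mono
          (nhdsWithin_mono a Ioi_subset_Ici_self))
        ((hq a hy).mono Ioi_subset_Ici_self)
    · exact (intervalIntegral.integral_hasDerivAt_right hay
        ((hq.mono Ioi_subset_Ici_self).stronglyMeasurableAtFilter isOpen_Ioi y hlt)
        (hq.continuousAt (Ici_mem_nhds hlt))).hasDerivWithinAt
  have hmono : MonotoneOn (fun y => -(f y * Real.exp (-∫ t in a..y, q t))) (Ici a) := by
    refine monotoneOn_Ici_of_hasDerivWithinAt_nonneg
      (fun y hy => (((hf y hy).hasDerivWithinAt).mul (hΦ y hy).neg.exp).neg) ?_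
    intro y hy
    have := mul_nonneg (sub_nonneg.2 (hle y hy)) (Real.exp_pos (-∫ t in a..y, q t)).le
    simp only [Pi.neg_apply]
    linarith
  have h := hmono self_mem_Ici hx hx
  simp only [intervalIntegral.integral_same, neg_zero, Real.exp_zero, mul_one,
    neg_le_neg_iff, Real.exp_neg] at h
  rw [← div_eq_mul_inv, div_le_iff₀ (Real.exp_pos _)] at h
  refine h.trans (mul_le_mul_of_nonneg_left (Real.exp_le_exp.2 ?_) hf0)
  rw [intervalIntegral.integral_of_le hx]
  exact setIntegral_mono_set hqi (ae_restrict_of_forall_mem measurableSet_Ici hq0)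
    (Ioc_subset_Icc_self.trans Icc_subset_Ici_self).eventuallyLE

/-- A solution of `G'' = q G` with `q ≥ 0`, `G 0 = 0` and `G' 0 = 1` is positive on `(0, ∞)`. -/
theorem jacobi_solution_pos {q G G' : ℝ → ℝ} (hq : ∀ x ∈ Ici (0 : ℝ), 0 ≤ q x)
    (hG : ∀ x ∈ Ici (0 : ℝ), HasDerivWithinAt G (G' x) (Ici 0) x)
    (hG' : ∀ x ∈ Ici (0 : ℝ), HasDerivWithinAt G' (q x * G x) (Ici 0) x)
    (hG0 : G 0 = 0) (hG'0 : G' 0 = 1) {x : ℝ} (hx : 0 < x) : 0 < G x := by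
  have hprod : ∀ y ∈ Ici (0 : ℝ), 0 ≤ G y * G' y := by
    have hmono : MonotoneOn (fun y => G y * G' y) (Ici 0) := by
      refine monotoneOn_Ici_of_hasDerivWithinAt_nonneg
        (fun y hy => (hG y hy).mul (hG' y hy)) fun y hy => ?_
      have := mul_nonneg (hq y hy) (sq_nonneg (G y))
      nlinarith [sq_nonneg (G' y)]
    intro y hy
    simpa [hG0] using hmono self_mem_Ici hy hy
  have hsq : MonotoneOn (fun y => G y * G y) (Ici 0) :=
    monotoneOn_Ici_of_hasDerivWithinAt_nonneg
      (fun y hy => (hG y hy).mul (hG y hy)) fun y hy => by linarith [hprod y hy]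
  obtain ⟨y, hy, hyx, hGy⟩ : ∃ y, 0 < y ∧ y < x ∧ 0 < G y := by
    have h := (hG 0 self_mem_Ici).mono (Ioi_subset_Ici_self (a := (0 : ℝ)))
    rw [hasDerivWithinAt_iff_tendsto_slope' (by simp), hG'0] at h
    obtain ⟨y, hslope, hy⟩ := ((h.eventually (lt_mem_nhds one_pos)).and
      (Ioo_mem_nhdsGT hx)).exists
    refine ⟨y, hy.1, hy.2, ?_⟩
    rw [slope_def_field, hG0, sub_zero, sub_zero] at hslope
    exact (div_pos_iff_of_pos_right hy.1).1 hslope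
  by_contra! hneg
  obtain ⟨z, hz, hGz⟩ : (0 : ℝ) ∈ G '' Icc y x := by
    refine intermediate_value_Icc' hyx.le (fun z hz => ?_) ⟨hneg, hGy.le⟩
    exact ((hG z (hy.le.trans hz.1)).continuousWithinAt).mono
      (Icc_subset_Ici_self.trans (Ici_subset_Ici.2 hy.le))
  have h := hsq (show y ∈ Ici 0 from hy.le) (show z ∈ Ici 0 from hy.le.trans hz.1) hz.1
  simp only [hGz, mul_zero] at h
  exact absurd h (not_le.2 (mul_pos hGy hGy))

/-- Finite total curvature implies integrability of `G'/G − 1/ρ` on `[1, ∞)`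
(part of Lemma 4.1 of the paper): if `k > 0` is continuous with
`∫₀^∞ ρ·k(ρ)² dρ < ∞` and `G'' = k²·G`, `G(0) = 0`, `G'(0) = 1`, then
`ρ ↦ G'(ρ)/G(ρ) − 1/ρ` is integrable on `[1, ∞)`. -/
theorem stmt5 (k G G' G'' : ℝ → ℝ)
    (hk_cont : ContinuousOn k (Set.Ici 0))
    (hk_pos : ∀ ρ, 0 ≤ ρ → 0 < k ρ)
    (hk_int : MeasureTheory.IntegrableOn (fun ρ => ρ * k ρ ^ 2) (Set.Ici 0))
    (hG''_cont : ContinuousOn G'' (Set.Ici 0))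
    (hd1 : ∀ ρ ∈ Set.Ici (0:ℝ), HasDerivWithinAt G (G' ρ) (Set.Ici 0) ρ)
    (hd2 : ∀ ρ ∈ Set.Ici (0:ℝ), HasDerivWithinAt G' (G'' ρ) (Set.Ici 0) ρ)
    (hG0 : G 0 = 0) (hG'0 : G' 0 = 1)
    (heq : ∀ ρ ∈ Set.Ici (0:ℝ), G'' ρ = k ρ ^ 2 * G ρ) :
    MeasureTheory.IntegrableOn (fun ρ => G' ρ / G ρ - 1 / ρ) (Set.Ici 1) := by
  have hq : ∀ x ∈ Ici (0 : ℝ), 0 ≤ k x ^ 2 := fun x _ => sq_nonneg _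
  have hd2' : ∀ x ∈ Ici (0 : ℝ), HasDerivWithinAt G' (k x ^ 2 * G x) (Ici 0) x :=
    fun x hx => heq x hx ▸ hd2 x hx
  have hpos : ∀ x, 0 < x → 0 < G x := fun x hx =>
    jacobi_solution_pos hq hd1 hd2' hG0 hG'0 hx
  have hnonneg : ∀ x ∈ Ici (0 : ℝ), 0 ≤ G x := fun x hx =>
    (eq_or_lt_of_le (mem_Ici.1 hx)).elim (fun h => by rw [← h, hG0]) fun h => (hpos x h).le
  have hGle : ∀ x ∈ Ici (0 : ℝ), G x ≤ x * G' x := by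
    have hmono : MonotoneOn (fun x => x * G' x - G x) (Ici 0) := by
      refine monotoneOn_Ici_of_hasDerivWithinAt_nonneg
        (fun x hx => ((hasDerivWithinAt_id x _).mul (hd2' x hx)).sub (hd1 x hx))
        fun x hx => ?_
      have := mul_nonneg (mem_Ici.1 hx) (mul_nonneg (hq x hx) (hnonneg x hx))
      simp only [id]
      linarith
    intro x hx
    simpa [hG0] using hmono self_mem_Ici hx hx
  have hsub : Ici (1 : ℝ) ⊆ Ici 0 := Ici_subset_Ici.2 zero_le_one
  have hlt : ∀ {x : ℝ}, x ∈ Ici (1 : ℝ) → 0 < x := fun hx => one_pos.trans_le hx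
  have hG'bound : ∀ x ∈ Ici (1 : ℝ),
      G' x ≤ G' 1 * Real.exp (∫ t in Ici (1 : ℝ), t * k t ^ 2) := by
    intro x hx
    refine le_mul_exp_setIntegral_of_deriv_le_mul (q := fun t => t * k t ^ 2)
      (f' := fun t => k t ^ 2 * G t)
      (continuousOn_id.mul ((hk_cont.mono hsub).pow 2))
      (fun t ht => mul_nonneg (hlt ht).le (sq_nonneg _)) (hk_int.mono_set hsub)
      (fun t ht => (hd2' t (hsub ht)).hasDerivAt (Ici_mem_nhds (hlt ht)))
      (fun t ht => ?_) ?_ hx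
    · have := mul_le_mul_of_nonneg_left (hGle t (hsub ht)) (sq_nonneg (k t))
      linarith
    · have := hGle 1 (mem_Ici.2 zero_le_one)
      linarith [hpos 1 one_pos]
  refine integrableOn_Ici_deriv_of_nonneg_of_le (f := fun x => Real.log (G x) - Real.log x)
    (C := Real.log (G' 1 * Real.exp (∫ t in Ici (1 : ℝ), t * k t ^ 2)))
    (fun x hx => ?_) (fun x hx => ?_) (fun x hx => ?_)
  · rw [one_div]
    exact (((hd1 x (hsub hx)).hasDerivAt (Ici_mem_nhds (hlt hx))).log (hpos x (hlt hx)).ne').sub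
      (Real.hasDerivAt_log (hlt hx).ne')
  · rw [sub_nonneg, div_le_div_iff₀ (hlt hx) (hpos x (hlt hx))]
    linarith [hGle x (hsub hx)]
  · rw [← Real.log_div (hpos x (hlt hx)).ne' (hlt hx).ne']
    refine Real.log_le_log (div_pos (hpos x (hlt hx)) (hlt hx)) (le_trans ?_ (hG'bound x hx))
    rw [div_le_iff₀' (hlt hx)]
    exact hGle x (hsub hx)
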